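/- For every δ > 0 and every continuous function f : S^d → ℝ, the mass of the von Mises–Fisher distribution away from the mean direction vanishes in the high-concentration limit: lim_{β→∞} I(β)⁻¹ ∫_{S^d \ B(s,δ)} |f(x)| exp(β⟨s,x⟩) dσ(x) = 0, where B(s,δ) is the open metric ball of radius δ around s. (Key localization step in the proof that P_0 = id for the von Mises–Fisher integral operators.) -/

import Mathlib

open MeasureTheory Filter Metric RealInnerProductSpace

/-- The unit sphere `S^d` in `ℝ^{d+1}`. -/
abbrev unitSphere (d : ℕ) := Metric.sphere (0 : EuclideanSpace ℝ (Fin (d + 1))) 1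

/-- The rotation-invariant surface measure `σ` on `S^d`, obtained from the Lebesgue
measure on `ℝ^{d+1}`. -/
noncomputable def sphereMeasure (d : ℕ) : Measure (unitSphere d) :=
  (volume : Measure (EuclideanSpace ℝ (Fin (d + 1)))).toSphere

/-- for every `δ > 0` and every continuous `f : S^d → ℝ`, the mass of the
von Mises–Fisher distribution away from the mean direction vanishes in the
high-concentration limit:
`lim_{β→∞} I(β)⁻¹ ∫_{S^d \ B(s,δ)} |f x| * exp (β ⟪s, x⟫) dσ x = 0`,
where `B(s,δ)` is the open metric ball of radius `δ` around `s` and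
`I(β) = ∫_{S^d} exp (β ⟪s, x⟫) dσ x`. -/
theorem vmf_mass_away_from_mean_tendsto_zero (d : ℕ) (hd : 1 ≤ d) (s : unitSphere d)
    (I : ℝ → ℝ)
    (hI : ∀ β : ℝ, I β =
      ∫ x : unitSphere d, Real.exp (β * ⟪(s : EuclideanSpace ℝ (Fin (d + 1))), (x : EuclideanSpace ℝ (Fin (d + 1)))⟫) ∂(sphereMeasure d))
    (δ : ℝ) (hδ : 0 < δ) (f : unitSphere d → ℝ) (hf : Continuous f) :
    Tendsto (fun β : ℝ => (I β)⁻¹ *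
        ∫ x in (Metric.ball s δ)ᶜ,
          |f x| * Real.exp (β * ⟪(s : EuclideanSpace ℝ (Fin (d + 1))), (x : EuclideanSpace ℝ (Fin (d + 1)))⟫) ∂(sphereMeasure d))
      atTop (nhds 0) := by
  have hin : ∀ x : unitSphere d, ⟪(s : EuclideanSpace ℝ (Fin (d + 1))),
      (x : EuclideanSpace ℝ (Fin (d + 1)))⟫ = 1 - dist x s ^ 2 / 2 := by
    intro x
    have h1 : ‖(s : EuclideanSpace ℝ (Fin (d + 1)))‖ = 1 := norm_eq_of_mem_sphere s
    have h2 : ‖(x : EuclideanSpace ℝ (Fin (d + 1)))‖ = 1 := norm_eq_of_mem_sphere x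
    have h3 := norm_sub_sq_real (x : EuclideanSpace ℝ (Fin (d + 1)))
      (s : EuclideanSpace ℝ (Fin (d + 1)))
    rw [h1, h2, real_inner_comm] at h3
    rw [Subtype.dist_eq, dist_eq_norm, h3]
    ring
  simp only [hin] at hI ⊢
  have : IsFiniteMeasure (sphereMeasure d) := by unfold sphereMeasure; infer_instance
  have : (sphereMeasure d).IsOpenPosMeasure := by unfold sphereMeasure; infer_instance
  have : CompactSpace (unitSphere d) := isCompact_iff_compactSpace.mp (isCompact_sphere _ _)
  have hint : ∀ g : unitSphere d → ℝ, Continuous g → Integrable g (sphereMeasure d) :=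
    fun g hg => hg.integrable_of_hasCompactSupport (HasCompactSupport.of_compactSpace g)
  obtain ⟨M, hM⟩ : ∃ M, ∀ x, |f x| ≤ M := by
    obtain ⟨M, hM⟩ := (isCompact_range hf.abs).bddAbove
    exact ⟨M, fun x => hM ⟨x, rfl⟩⟩
  have hM0 : 0 ≤ M := (abs_nonneg _).trans (hM s)
  have hc : 0 < (sphereMeasure d).real (ball s (δ / 2)) := by
    apply ENNReal.toReal_pos
    · exact (measure_ball_pos _ _ (by positivity)).ne'
    · exact measure_ne_top _ _
  set c := (sphereMeasure d).real (ball s (δ / 2)) with hcdef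
  set m := (sphereMeasure d).real (ball s δ)ᶜ with hmdef
  have hnum : ∀ β : ℝ, 0 ≤ β → ∫ x in (Metric.ball s δ)ᶜ,
      |f x| * Real.exp (β * (1 - dist x s ^ 2 / 2)) ∂(sphereMeasure d)
      ≤ M * Real.exp (β * (1 - δ ^ 2 / 2)) * m := by
    intro β hβ
    have h := setIntegral_mono_on (μ := sphereMeasure d) (s := (ball s δ)ᶜ)
      (f := fun x => |f x| * Real.exp (β * (1 - dist x s ^ 2 / 2)))
      (g := fun _ => M * Real.exp (β * (1 - δ ^ 2 / 2)))
      (hint _ (by fun_prop)).integrableOn (integrable_const _).integrableOn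
      measurableSet_ball.compl (by
        intro x hx
        have hx' : δ ≤ dist x s := by simpa using hx
        have := hM x
        gcongr)
    rw [setIntegral_const, smul_eq_mul] at h
    linarith
  have hden : ∀ β : ℝ, 0 ≤ β → c * Real.exp (β * (1 - (δ / 2) ^ 2 / 2)) ≤ I β := by
    intro β hβ
    have h := setIntegral_mono_on (μ := sphereMeasure d) (s := ball s (δ / 2))
      (g := fun x => Real.exp (β * (1 - dist x s ^ 2 / 2)))
      (f := fun _ => Real.exp (β * (1 - (δ / 2) ^ 2 / 2)))
      (integrable_const _).integrableOn (hint _ (by fun_prop)).integrableOn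
      measurableSet_ball (by
        intro x hx
        have hx' : dist x s ≤ δ / 2 := (mem_ball.mp hx).le
        gcongr)
    rw [setIntegral_const, smul_eq_mul] at h
    rw [hI]
    exact h.trans (setIntegral_le_integral (hint _ (by fun_prop))
      (Eventually.of_forall fun x => (Real.exp_pos _).le))
  have hlim : Tendsto (fun β : ℝ => (c⁻¹ * M * m) * Real.exp (-((3 * δ ^ 2 / 8) * β)))
      atTop (nhds 0) := by
    have h1 : Tendsto (fun β : ℝ => (3 * δ ^ 2 / 8) * β) atTop atTop :=
      tendsto_id.const_mul_atTop (by positivity)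
    simpa using (Real.tendsto_exp_neg_atTop_nhds_zero.comp h1).const_mul (c⁻¹ * M * m)
  refine tendsto_of_tendsto_of_tendsto_of_le_of_le' tendsto_const_nhds hlim ?_ ?_
  · filter_upwards with β
    have hI0 : 0 ≤ I β := by
      rw [hI]
      exact integral_nonneg fun x => (Real.exp_pos _).le
    exact mul_nonneg (inv_nonneg.mpr hI0) (integral_nonneg fun x => by positivity)
  · filter_upwards [eventually_ge_atTop 0] with β hβ
    have hpos : 0 < c * Real.exp (β * (1 - (δ / 2) ^ 2 / 2)) := by positivity
    have hm0 : 0 ≤ m := measureReal_nonneg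
    calc _ ≤ (c * Real.exp (β * (1 - (δ / 2) ^ 2 / 2)))⁻¹ *
          (M * Real.exp (β * (1 - δ ^ 2 / 2)) * m) := by
          apply mul_le_mul (inv_anti₀ hpos (hden β hβ)) (hnum β hβ)
            (integral_nonneg fun x => by positivity) (by positivity)
      _ = _ := by
          rw [mul_inv, ← Real.exp_neg]
          have : Real.exp (-((3 * δ ^ 2 / 8) * β)) =
              Real.exp (-(β * (1 - (δ / 2) ^ 2 / 2))) * Real.exp (β * (1 - δ ^ 2 / 2)) := by
            rw [← Real.exp_add]
            congr 1
            ring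
          rw [this]
          ring
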